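/- Let Z have an absolutely continuous law and let τ take two values T_1 < T_2, each with probability 1/2. Then the Brownian bridge ζ with length τ and pinning point Z is not a Markov process with respect to its natural filtration: there exist 0 < t_1 < T_1 < t_2 < T_2 < u and a bounded measurable g with E[g(ζ_u) | ζ_{t_1}, ζ_{t_2}] ≠ E[g(ζ_u) | ζ_{t_2}] on a set of positive probability. -/

import Mathlib

open MeasureTheory ProbabilityTheory Real Set

noncomputable def gaussD (v x m : ℝ) : ℝ :=
  (Real.sqrt (2 * Real.pi * v))⁻¹ * Real.exp (-((x - m) ^ 2) / (2 * v))

def IsBrownianMotion {Ω : Type*} [MeasurableSpace Ω] (P : Measure Ω)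
    (W : ℝ → Ω → ℝ) : Prop :=
  (∀ ω, W 0 ω = 0) ∧ (∀ ω, Continuous fun t => W t ω) ∧
  (∀ t, Measurable (W t)) ∧
  (∀ s t : ℝ, 0 ≤ s → s ≤ t →
    P.map (fun ω => W t ω - W s ω) = gaussianReal 0 (t - s).toNNReal) ∧
  (∀ s t u v : ℝ, 0 ≤ s → s ≤ t → t ≤ u → u ≤ v →
    IndepFun (fun ω => W t ω - W s ω) (fun ω => W v ω - W u ω) P)

noncomputable def bridge {Ω : Type*} (W : ℝ → Ω → ℝ) (r z t : ℝ) (ω : Ω) : ℝ :=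
  W (min t r) ω - (min t r / r) * W r ω + (min t r / r) * z

noncomputable def rbridge {Ω : Type*} (W : ℝ → Ω → ℝ) (τ Z : Ω → ℝ) (t : ℝ) (ω : Ω) : ℝ :=
  bridge W (τ ω) (Z ω) t ω

def IndepLPW {Ω : Type*} [MeasurableSpace Ω] (P : Measure Ω) (τ Z : Ω → ℝ)
    (W : ℝ → Ω → ℝ) : Prop :=
  IndepFun τ Z P ∧ IndepFun (fun ω => (τ ω, Z ω)) (fun ω (t : ℝ) => W t ω) P

noncomputable def natFc {Ω : Type*} [MeasurableSpace Ω] (P : Measure Ω)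
    (X : ℝ → Ω → ℝ) (t : ℝ) : MeasurableSpace Ω :=
  (⨆ s ∈ Set.Iic t, MeasurableSpace.comap (X s) Real.measurableSpace) ⊔
    MeasurableSpace.generateFrom {s : Set Ω | P s = 0}

lemma aux_half (μ : Measure ℝ) [IsProbabilityMeasure μ] (h : ∀ x, μ {x} = 0) :
    ∃ D : Set ℝ, MeasurableSet D ∧ μ D ≠ 0 ∧ μ Dᶜ ≠ 0 := by
  have hc : Continuous (cdf μ) := by
    rw [continuous_iff_continuousAt]
    intro x
    rw [(cdf μ).mono.continuousAt_iff_leftLim_eq_rightLim, StieltjesFunction.rightLim_eq]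
    have h1 := (cdf μ).measure_singleton x
    rw [measure_cdf, h x] at h1
    have h2 := ENNReal.ofReal_eq_zero.1 h1.symm
    have h3 := (cdf μ).mono.leftLim_le (le_refl x)
    linarith
  have h1 : ∃ a, cdf μ a ≤ 1/2 :=
    ((tendsto_cdf_atBot μ).eventually (ge_mem_nhds (by norm_num : (0:ℝ) < 1/2))).exists
  have h2 : ∃ a, 1/2 ≤ cdf μ a :=
    ((tendsto_cdf_atTop μ).eventually (le_mem_nhds (by norm_num : (1/2:ℝ) < 1))).exists
  obtain ⟨a, ha⟩ := mem_range_of_exists_le_of_exists_ge hc h1 h2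
  rw [cdf_eq_real] at ha
  refine ⟨Iic a, measurableSet_Iic, ?_, ?_⟩
  · intro h0
    simp [measureReal_def, h0] at ha
  · intro h0
    have := (prob_compl_eq_zero_iff (μ := μ) (measurableSet_Iic (a := a))).1 h0
    simp [measureReal_def, this] at ha

lemma aux_limit {Ω : Type*} [mΩ : MeasurableSpace Ω] (P : Measure Ω) [IsProbabilityMeasure P]
    (X : ℕ → Ω → ℝ) (X' Y : Ω → ℝ) (hX : ∀ n, Measurable (X n)) (hX' : Measurable X')
    (hY : Measurable Y)
    (hlim : ∀ ω, Filter.Tendsto (fun n => X n ω) Filter.atTop (nhds (X' ω)))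
    (G : Ω → ℝ) (hG : Integrable G P)
    (h : ∀ n, P[G | MeasurableSpace.comap (X n) Real.measurableSpace ⊔
              MeasurableSpace.comap Y Real.measurableSpace]
          =ᵐ[P] P[G | MeasurableSpace.comap Y Real.measurableSpace])
    (A : Set ℝ) (hA : MeasurableSet A) :
    ∫ ω in Y ⁻¹' A ∩ {ω | X' ω = Y ω},
      (G ω - (P[G | MeasurableSpace.comap Y Real.measurableSpace]) ω) ∂P = 0 := by
  set φ := P[G | MeasurableSpace.comap Y Real.measurableSpace] with hφ
  have hφi : Integrable φ P := integrable_condExp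
  let H : Ω → ℝ := G - φ
  have hH : Integrable H P := hG.sub hφi
  let K : ℕ → (Ω → ℝ) → Ω → ℝ := fun m V ω =>
    (Y ⁻¹' A).indicator 1 ω * Real.exp (-(m * |V ω - Y ω|))
  have hKb : ∀ m V ω, ‖K m V ω‖ ≤ 1 := by
    intro m V ω
    simp only [K, norm_mul]
    have h1 : ‖(Y ⁻¹' A).indicator (1 : Ω → ℝ) ω‖ ≤ 1 := by
      by_cases hω : ω ∈ Y ⁻¹' A <;> simp [hω]
    have h2 : ‖Real.exp (-(m * |V ω - Y ω|))‖ ≤ 1 := by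
      rw [Real.norm_eq_abs, abs_of_pos (Real.exp_pos _), Real.exp_le_one_iff]
      have : (0:ℝ) ≤ m * |V ω - Y ω| := by positivity
      linarith
    exact mul_le_one₀ h1 (norm_nonneg _) h2
  have hKm : ∀ m V, Measurable V → Measurable (K m V) := by
    intro m V hV
    have : Measurable ((Y ⁻¹' A).indicator (1 : Ω → ℝ)) := measurable_one.indicator (hY hA)
    simp only [K]
    fun_prop
  have hKHb : ∀ m V ω, ‖K m V ω * H ω‖ ≤ ‖H ω‖ := by
    intro m V ω
    rw [norm_mul]
    exact mul_le_of_le_one_left (norm_nonneg _) (hKb m V ω)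
  have hKHm : ∀ m V, Measurable V → AEStronglyMeasurable (fun ω => K m V ω * H ω) P := by
    intro m V hV
    exact (hKm m V hV).aestronglyMeasurable.mul hH.1
  have step1 : ∀ m n, ∫ ω, K m (X n) ω * H ω ∂P = 0 := by
    intro m n
    set 𝓜 := MeasurableSpace.comap (X n) Real.measurableSpace ⊔
              MeasurableSpace.comap Y Real.measurableSpace with h𝓜
    have hle : 𝓜 ≤ mΩ := sup_le (hX n).comap_le hY.comap_le
    have hXm : Measurable[𝓜] (X n) := (comap_measurable (X n)).mono le_sup_left le_rfl
    have hYm : Measurable[𝓜] Y := (comap_measurable Y).mono le_sup_right le_rfl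
    have hk : StronglyMeasurable[𝓜] (K m (X n)) := by
      apply Measurable.stronglyMeasurable
      have : Measurable[𝓜] ((Y ⁻¹' A).indicator (1 : Ω → ℝ)) :=
        measurable_one.indicator (hYm hA)
      simp only [K]
      exact this.mul (Real.measurable_exp.comp
        (((hXm.sub hYm).abs.const_mul (m:ℝ)).neg))
    have hHz : P[H | 𝓜] =ᵐ[P] 0 := by
      have h1 := condExp_sub hG hφi 𝓜
      have h2 : P[φ | 𝓜] = φ := condExp_of_stronglyMeasurable hle
        (stronglyMeasurable_condExp.mono le_sup_right) hφi
      filter_upwards [h1, h n] with ω h1 h3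
      change P[G - φ | 𝓜] ω = 0
      rw [h1, Pi.sub_apply, h3, h2]
      simp [hφ]
    have hi : Integrable (K m (X n) * H) P :=
      hH.mono (hKHm m (X n) (hX n)) (Filter.Eventually.of_forall (hKHb m (X n)))
    have h4 := condExp_mul_of_stronglyMeasurable_left hk hi hH
    have h5 := integral_condExp (μ := P) (f := K m (X n) * H) hle
    rw [integral_congr_ae (h4.trans ((Filter.EventuallyEq.refl _ _).mul hHz))] at h5
    simpa using h5.symm
  have step2 : ∀ m, ∫ ω, K m X' ω * H ω ∂P = 0 := by
    intro m
    have := tendsto_integral_of_dominated_convergence (μ := P)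
      (F := fun n ω => K m (X n) ω * H ω) (f := fun ω => K m X' ω * H ω) (fun ω => ‖H ω‖)
      (fun n => hKHm m _ (hX n)) hH.norm
      (fun n => Filter.Eventually.of_forall (hKHb m (X n)))
      (Filter.Eventually.of_forall (fun ω => by
        apply Filter.Tendsto.mul_const
        apply Filter.Tendsto.const_mul
        apply (Real.continuous_exp.tendsto _).comp
        exact ((((hlim ω).sub_const _).abs).const_mul _).neg))
    simp only [step1] at this
    exact (tendsto_nhds_unique this tendsto_const_nhds)
  have hS : MeasurableSet (Y ⁻¹' A ∩ {ω | X' ω = Y ω}) :=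
    (hY hA).inter (measurableSet_eq_fun hX' hY)
  have := tendsto_integral_of_dominated_convergence (μ := P)
      (F := fun m ω => K m X' ω * H ω)
      (f := (Y ⁻¹' A ∩ {ω | X' ω = Y ω}).indicator H) (fun ω => ‖H ω‖)
      (fun m => hKHm m _ hX') hH.norm
      (fun n => Filter.Eventually.of_forall (hKHb n X'))
      (Filter.Eventually.of_forall (fun ω => by
        by_cases h1 : ω ∈ Y ⁻¹' A
        · by_cases h2 : X' ω = Y ω
          · have h3 : ω ∈ (Y ⁻¹' A ∩ {ω | X' ω = Y ω}) := ⟨h1, h2⟩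
            have h4 : ∀ m, K m X' ω * H ω = H ω := by
              intro m; simp only [K]; rw [indicator_of_mem h1, h2]; simp
            simp only [h4]
            rw [indicator_of_mem h3]
            exact tendsto_const_nhds
          · have h3 : ω ∉ (Y ⁻¹' A ∩ {ω | X' ω = Y ω}) := fun h => h2 h.2
            rw [indicator_of_notMem h3, ← zero_mul (H ω)]
            apply Filter.Tendsto.mul_const
            simp only [K]
            rw [← mul_zero ((Y ⁻¹' A).indicator (1 : Ω → ℝ) ω)]
            apply Filter.Tendsto.const_mul
            apply Real.tendsto_exp_neg_atTop_nhds_zero.comp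
            exact tendsto_natCast_atTop_atTop.atTop_mul_const (abs_pos.2 (sub_ne_zero.2 h2))
        · have h3 : ω ∉ (Y ⁻¹' A ∩ {ω | X' ω = Y ω}) := fun h => h1 h.1
          rw [indicator_of_notMem h3]
          have h4 : ∀ m, K m X' ω * H ω = 0 := by
            intro m; simp only [K]; rw [indicator_of_notMem h1]; simp
          simp only [h4]
          exact tendsto_const_nhds))
  simp only [step2] at this
  rw [integral_indicator hS] at this
  exact tendsto_nhds_unique this tendsto_const_nhds

lemma aux_gauss {Ω : Type*} [MeasurableSpace Ω] (P : Measure Ω) [IsProbabilityMeasure P]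
    (W : ℝ → Ω → ℝ) (hW : IsBrownianMotion P W) (t T : ℝ) (ht : 0 < t) (hT : t < T) :
    volume ≪ P.map (fun ω => W t ω - t / T * W T ω) := by
  obtain ⟨h0, -, hm, hg, hi⟩ := hW
  have l1 : HasLaw (fun ω => W t ω - W 0 ω) (gaussianReal 0 (t - 0).toNNReal) P :=
    ⟨((hm t).sub (hm 0)).aemeasurable, hg 0 t le_rfl ht.le⟩
  have l2 : HasLaw (fun ω => W T ω - W t ω) (gaussianReal 0 (T - t).toNNReal) P :=
    ⟨((hm T).sub (hm t)).aemeasurable, hg t T ht.le hT.le⟩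
  have hind := (hi 0 t t T le_rfl ht.le le_rfl hT.le).comp
    (φ := fun x => (1 - t / T) * x) (ψ := fun x => (-(t / T)) * x)
    (measurable_const_mul _) (measurable_const_mul _)
  have key := gaussianReal_add_gaussianReal_of_indepFun hind
    (gaussianReal_const_mul l1 _).map_eq (gaussianReal_const_mul l2 _).map_eq
  have e : ((fun x => (1 - t / T) * x) ∘ fun ω => W t ω - W 0 ω) +
      ((fun x => (-(t / T)) * x) ∘ fun ω => W T ω - W t ω)
      = fun ω => W t ω - t / T * W T ω := by
    funext ω
    simp [h0]
    ring
  rw [e] at key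
  rw [key]
  apply gaussianReal_absolutelyContinuous'
  have hs : t / T < 1 := (div_lt_one (ht.trans hT)).2 hT
  intro h
  have h1 := (add_eq_zero.1 h).1
  have h2 := congrArg NNReal.toReal h1
  simp only [sub_zero, NNReal.coe_mul, NNReal.coe_zero, Real.coe_toNNReal _ ht.le, NNReal.coe_mk] at h2
  have : 0 < (1 - t/T)^2 * t := by
    have : 0 < 1 - t / T := by linarith
    positivity
  exact this.ne' h2

lemma aux_ne {Ω : Type*} [MeasurableSpace Ω] (P : Measure Ω) [IsProbabilityMeasure P]
    (Z V : Ω → ℝ) (hZ : Measurable Z) (hV : Measurable V) (h : IndepFun Z V P)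
    (hz : ∀ x, P.map Z {x} = 0) : P {ω | Z ω = V ω} = 0 := by
  have h' := (indepFun_iff_map_prod_eq_prod_map_map hV.aemeasurable hZ.aemeasurable).1 h.symm
  have hS : MeasurableSet {p : ℝ × ℝ | p.2 = p.1} := measurableSet_eq_fun measurable_snd measurable_fst
  have : P {ω | Z ω = V ω} = P.map (fun ω => (V ω, Z ω)) {p : ℝ × ℝ | p.2 = p.1} := by
    rw [Measure.map_apply (hV.prodMk hZ) hS]; rfl
  have := Measure.isProbabilityMeasure_map (μ := P) hZ.aemeasurable
  rw [‹P {ω | Z ω = V ω} = _›, h', Measure.measure_prod_null hS]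
  exact Filter.Eventually.of_forall fun x => hz x

lemma aux_pos {Ω : Type*} [MeasurableSpace Ω] (P : Measure Ω) [IsProbabilityMeasure P]
    (τ Z V : Ω → ℝ) (hτ : Measurable τ) (hZ : Measurable Z) (hV : Measurable V)
    (h1 : IndepFun τ Z P) (h2 : IndepFun (fun ω => (τ ω, Z ω)) V P)
    (hac : volume ≪ P.map V) (c T : ℝ) (hT : P {ω | τ ω = T} ≠ 0)
    (D A : Set ℝ) (hD : MeasurableSet D) (hA : MeasurableSet A)
    (hDz : P.map Z Dᶜ ≠ 0) (hAv : volume A ≠ 0) :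
    P {ω | τ ω = T ∧ Z ω ∉ D ∧ V ω + c * Z ω ∈ A} ≠ 0 := by
  intro h0
  have h' := (indepFun_iff_map_prod_eq_prod_map_map (hτ.prodMk hZ).aemeasurable
    hV.aemeasurable).1 h2
  let S : Set ((ℝ × ℝ) × ℝ) := {p | p.1.1 = T ∧ p.1.2 ∉ D ∧ p.2 + c * p.1.2 ∈ A}
  have hS : MeasurableSet S := by
    refine MeasurableSet.inter (measurableSet_eq_fun (by fun_prop) (by fun_prop))
      (MeasurableSet.inter ?_ ?_)
    · exact (hD.compl).preimage (measurable_snd.comp measurable_fst)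
    · exact hA.preimage (f := fun p : (ℝ × ℝ) × ℝ => p.2 + c * p.1.2) (by fun_prop)
  have e : P {ω | τ ω = T ∧ Z ω ∉ D ∧ V ω + c * Z ω ∈ A}
      = P.map (fun ω => ((τ ω, Z ω), V ω)) S := by
    rw [Measure.map_apply ((hτ.prodMk hZ).prodMk hV) hS]; rfl
  have := Measure.isProbabilityMeasure_map (μ := P) hV.aemeasurable
  rw [e, h', Measure.measure_prod_null hS] at h0
  have h3 : ∀ᵐ p ∂(P.map (fun ω => (τ ω, Z ω))), ¬ (p.1 = T ∧ p.2 ∉ D) := by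
    filter_upwards [h0] with p hp hp'
    have h4 : Prod.mk p ⁻¹' S = (fun x => x + c * p.2) ⁻¹' A := by
      ext x
      simp only [S, mem_preimage, mem_ofPred_eq]
      tauto
    rw [h4] at hp
    have h5 := hac hp
    rw [measure_preimage_add_right] at h5
    exact hAv h5
  have h4 := ae_of_ae_map (hτ.prodMk hZ).aemeasurable h3
  have h5 : P (τ ⁻¹' {T} ∩ Z ⁻¹' Dᶜ) = 0 := by
    rw [ae_iff] at h4
    convert h4 using 2
    ext ω; simp
  rw [h1.measure_inter_preimage_eq_mul _ _ (measurableSet_singleton T) hD.compl,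
    mul_eq_zero] at h5
  rcases h5 with h5 | h5
  · exact hT h5
  · rw [Measure.map_apply hZ hD.compl] at hDz
    exact hDz h5

theorem stmt13 {Ω : Type*} [MeasurableSpace Ω] (P : Measure Ω) [IsProbabilityMeasure P]
    (W : ℝ → Ω → ℝ) (hW : IsBrownianMotion P W)
    (τ Z : Ω → ℝ) (hτ : Measurable τ) (hZ : Measurable Z) (hτpos : ∀ ω, 0 < τ ω)
    (hInd : IndepLPW P τ Z W)
    (T1 T2 : ℝ) (hT1 : 0 < T1) (hT12 : T1 < T2)
    (hτ1 : P {ω | τ ω = T1} = 1 / 2) (hτ2 : P {ω | τ ω = T2} = 1 / 2)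
    (f : ℝ → ℝ) (hf : Measurable f)
    (hZf : P.map Z = volume.withDensity fun x => ENNReal.ofReal (f x)) :
    ∃ (t1 t2 u : ℝ) (g : ℝ → ℝ),
      0 < t1 ∧ t1 < T1 ∧ T1 < t2 ∧ t2 < T2 ∧ T2 < u ∧
      Measurable g ∧ (∃ C, ∀ x, |g x| ≤ C) ∧
      ¬ (P[(fun ω => g (rbridge W τ Z u ω)) |
            MeasurableSpace.comap (rbridge W τ Z t1) Real.measurableSpace ⊔
              MeasurableSpace.comap (rbridge W τ Z t2) Real.measurableSpace]
          =ᵐ[P]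
         P[(fun ω => g (rbridge W τ Z u ω)) |
            MeasurableSpace.comap (rbridge W τ Z t2) Real.measurableSpace]) := by
  obtain ⟨hI1, hI2⟩ := hInd
  have hW' := hW
  obtain ⟨hW0, hWc, hWm, -, -⟩ := hW'
  have hμP := Measure.isProbabilityMeasure_map (μ := P) hZ.aemeasurable
  have hac : P.map Z ≪ volume := by
    rw [hZf]; exact withDensity_absolutelyContinuous _ _
  have hz : ∀ x, P.map Z {x} = 0 := fun x => hac (by simp)
  obtain ⟨D, hD, hD0, hD1⟩ := aux_half (P.map Z) hz
  have hT2 : 0 < T2 := hT1.trans hT12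
  have hunc : Measurable (Function.uncurry W) :=
    measurable_uncurry_of_continuous_of_measurable hWc hWm
  have hζm : ∀ t, Measurable (rbridge W τ Z t) := by
    intro t
    have a1 : Measurable fun ω => W (min t (τ ω)) ω :=
      hunc.comp ((measurable_const.min hτ).prodMk measurable_id)
    have a2 : Measurable fun ω => W (τ ω) ω := hunc.comp (hτ.prodMk measurable_id)
    unfold rbridge bridge
    fun_prop
  have hζc : ∀ ω, Continuous fun t => rbridge W τ Z t ω := by
    intro ω
    have a1 : Continuous fun t => W (min t (τ ω)) ω :=
      (hWc ω).comp (continuous_id.min continuous_const)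
    unfold rbridge bridge
    have := (hτpos ω).ne'
    fun_prop
  obtain ⟨t2, ht2, ht2'⟩ := exists_between hT12
  have ht20 : 0 < t2 := hT1.trans ht2
  have hend : ∀ ω t, τ ω ≤ t → rbridge W τ Z t ω = Z ω := by
    intro ω t h
    unfold rbridge bridge
    rw [min_eq_right h, div_self (hτpos ω).ne']
    ring
  have hmid : ∀ ω t, τ ω = T2 → t ≤ T2 →
      rbridge W τ Z t ω = (W t ω - t / T2 * W T2 ω) + t / T2 * Z ω := by
    intro ω t h h'
    unfold rbridge bridge
    rw [h, min_eq_left h']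
  have hms1 : MeasurableSet {ω | τ ω = T1} := measurableSet_eq_fun hτ measurable_const
  have hms2 : MeasurableSet {ω | τ ω = T2} := measurableSet_eq_fun hτ measurable_const
  have hτae : ∀ᵐ ω ∂P, τ ω = T1 ∨ τ ω = T2 := by
    have hdis : Disjoint {ω | τ ω = T1} {ω | τ ω = T2} := by
      rw [Set.disjoint_left]
      intro ω h1 h2
      have h1' : τ ω = T1 := h1
      have h2' : τ ω = T2 := h2
      linarith
    have h1 : P ({ω | τ ω = T1} ∪ {ω | τ ω = T2}) = 1 := by
      rw [measure_union hdis hms2, hτ1, hτ2, ENNReal.add_halves]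
    exact (prob_compl_eq_zero_iff (hms1.union hms2)).2 h1
  have hVm : ∀ a b c d : ℝ, Measurable fun w : ℝ → ℝ => w a * b + w c * d := by
    intro a b c d; fun_prop
  have hind2 : IndepFun (fun ω => (τ ω, Z ω)) (fun ω => W t2 ω - t2 / T2 * W T2 ω) P :=
    hI2.comp (φ := id) (ψ := fun w : ℝ → ℝ => w t2 - t2 / T2 * w T2) measurable_id
      (by fun_prop)
  set s : ℝ := (t2 - T1) / T2 with hs
  have hs0 : s ≠ 0 := (div_pos (by linarith) hT2).ne'
  have hind3 : IndepFun Z (fun ω => ((W T1 ω - T1 / T2 * W T2 ω)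
      - (W t2 ω - t2 / T2 * W T2 ω)) / s) P :=
    hI2.comp (φ := Prod.snd) (ψ := fun w : ℝ → ℝ => ((w T1 - T1 / T2 * w T2)
      - (w t2 - t2 / T2 * w T2)) / s) measurable_snd (by fun_prop)
  have hne := aux_ne P Z _ hZ (by have := hWm T1; have := hWm T2; have := hWm t2; fun_prop) hind3 hz
  have hev : ∀ᵐ ω ∂P, (rbridge W τ Z T1 ω = rbridge W τ Z t2 ω ↔ τ ω = T1) := by
    have hne' : ∀ᵐ ω ∂P, ¬ Z ω = ((W T1 ω - T1 / T2 * W T2 ω)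
      - (W t2 ω - t2 / T2 * W T2 ω)) / s := by
      rw [ae_iff]; simpa using hne
    filter_upwards [hτae, hne'] with ω h1 h2
    constructor
    · intro h3
      rcases h1 with h1 | h1
      · exact h1
      · exfalso
        rw [hmid ω T1 h1 hT12.le, hmid ω t2 h1 ht2'.le] at h3
        apply h2
        rw [eq_div_iff hs0, hs, sub_div]
        linarith
    · intro h3
      rw [hend ω T1 h3.le, hend ω t2 (h3.le.trans ht2.le)]
  set Y := rbridge W τ Z t2 with hYdef
  have hYm : Measurable Y := hζm t2
  let g : ℝ → ℝ := D.indicator 1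
  have hgm : Measurable g := measurable_one.indicator hD
  have hgb : ∀ x, |g x| ≤ 1 := by
    intro x
    by_cases hx : x ∈ D <;> simp [g, hx]
  by_contra hcon
  have hall : ∀ t1, 0 < t1 → t1 < T1 →
      P[(fun ω => g (rbridge W τ Z (T2 + 1) ω)) |
            MeasurableSpace.comap (rbridge W τ Z t1) Real.measurableSpace ⊔
              MeasurableSpace.comap Y Real.measurableSpace]
          =ᵐ[P]
         P[(fun ω => g (rbridge W τ Z (T2 + 1) ω)) |
            MeasurableSpace.comap Y Real.measurableSpace] := by
    intro t1 h1 h2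
    by_contra h3
    exact hcon ⟨t1, t2, T2 + 1, g, h1, h2, ht2, ht2', by linarith, hgm, ⟨1, hgb⟩, h3⟩
  set G : Ω → ℝ := fun ω => g (rbridge W τ Z (T2 + 1) ω) with hGdef
  have hGm : Measurable G := hgm.comp (hζm _)
  have hGi : Integrable G P :=
    Integrable.of_bound hGm.aestronglyMeasurable 1 (Filter.Eventually.of_forall fun ω => hgb _)
  have hGZ : ∀ᵐ ω ∂P, G ω = g (Z ω) := by
    filter_upwards [hτae] with ω h
    simp only [hGdef]
    rw [hend]
    rcases h with h | h <;> linarith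
  set φ := P[G | MeasurableSpace.comap Y Real.measurableSpace] with hφ
  have hφ1 : ∀ᵐ ω ∂P, φ ω ≤ 1 := by
    have h1 := condExp_mono (m := MeasurableSpace.comap Y Real.measurableSpace) hGi
      (integrable_const (1:ℝ)) (Filter.Eventually.of_forall fun ω => (le_abs_self _).trans (hgb _))
    rw [condExp_const hYm.comap_le] at h1
    exact h1
  have hφi : Integrable φ P := integrable_condExp
  obtain ⟨tn, htn1, htn2, htn3⟩ := exists_seq_strictMono_tendsto' hT1
  have hlim := aux_limit P (fun n => rbridge W τ Z (tn n)) (rbridge W τ Z T1) Y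
    (fun n => hζm _) (hζm _) hYm
    (fun ω => ((hζc ω).tendsto T1).comp htn3) G hGi
    (fun n => hall (tn n) (htn2 n).1 (htn2 n).2) D hD
  set S : Set Ω := Y ⁻¹' D ∩ {ω | rbridge W τ Z T1 ω = Y ω} with hS
  have hSm : MeasurableSet S := (hYm hD).inter (measurableSet_eq_fun (hζm _) hYm)
  have hSG : ∀ᵐ ω ∂P, ω ∈ S → G ω = 1 := by
    filter_upwards [hev, hGZ] with ω h1 h2 h3
    have h4 := h1.1 h3.2
    have h5 : Y ω = Z ω := hend ω t2 (h4.le.trans ht2.le)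
    have h6 : Z ω ∈ D := h5 ▸ h3.1
    rw [h2]
    simp [g, h6]
  have hSφ : ∀ᵐ ω ∂P, ω ∈ S → φ ω = 1 := by
    have h1 : 0 ≤ᵐ[P.restrict S] fun ω => G ω - φ ω := by
      rw [Filter.EventuallyLE, ae_restrict_iff' hSm]
      filter_upwards [hSG, hφ1] with ω h1 h2 h3
      rw [h1 h3]
      simpa using h2
    have h2 := (setIntegral_eq_zero_iff_of_nonneg_ae h1 (hGi.sub hφi).integrableOn).1 hlim
    rw [Filter.EventuallyEq, ae_restrict_iff' hSm] at h2
    filter_upwards [h2, hSG] with ω h3 h4 h5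
    have h6 := h3 h5
    rw [h4 h5] at h6
    simp only [Pi.zero_apply] at h6
    linarith
  have hEm : MeasurableSet[MeasurableSpace.comap Y Real.measurableSpace] (φ ⁻¹' {1}) :=
    (stronglyMeasurable_condExp.measurable) (measurableSet_singleton 1)
  obtain ⟨A, hA, hAE⟩ := hEm
  have hAD : P.map Z A ≠ 0 := by
    intro h0
    rw [Measure.map_apply hZ hA] at h0
    have h1 : P (τ ⁻¹' {T1} ∩ Z ⁻¹' D) = 0 := by
      refine measure_mono_null_ae ?_ h0
      filter_upwards [hSφ, hev] with ω h1 h2 h3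
      have h4 : τ ω = T1 := h3.1
      have h5 : Y ω = Z ω := hend ω t2 (h4.le.trans ht2.le)
      have h6 : ω ∈ S := ⟨by
        change Y ω ∈ D
        rw [h5]; exact h3.2, h2.2 h4⟩
      have h7 : ω ∈ Y ⁻¹' A := by
        rw [hAE]; exact h1 h6
      change Z ω ∈ A
      rw [← h5]; exact h7
    rw [hI1.measure_inter_preimage_eq_mul _ _ (measurableSet_singleton T1) hD, mul_eq_zero] at h1
    rcases h1 with h1 | h1
    · have h2 : P {ω | τ ω = T1} = 0 := h1
      rw [hτ1] at h2
      simp at h2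
    · rw [Measure.map_apply hZ hD] at hD0
      exact hD0 h1
  have hAv : volume A ≠ 0 := fun h => hAD (hac h)
  have hVmeas : Measurable fun ω => W t2 ω - t2 / T2 * W T2 ω := by
    have := hWm T2; have := hWm t2; fun_prop
  have hpos := aux_pos P τ Z _ hτ hZ hVmeas hI1 hind2
    (aux_gauss P W hW t2 T2 ht20 ht2') (t2 / T2) T2 (by rw [hτ2]; simp) D A hD hA hD1 hAv
  apply hpos
  have hE : ∀ᵐ ω ∂P, ω ∈ Y ⁻¹' A → G ω = 1 := by
    have hEmm : MeasurableSet (Y ⁻¹' A) := hYm hA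
    have h1 : ∫ ω in Y ⁻¹' A, φ ω ∂P = ∫ ω in Y ⁻¹' A, G ω ∂P :=
      setIntegral_condExp hYm.comap_le hGi ⟨A, hA, rfl⟩
    have h2 : ∫ ω in Y ⁻¹' A, φ ω ∂P = ∫ ω in Y ⁻¹' A, (1:ℝ) ∂P := by
      apply setIntegral_congr_fun hEmm
      intro ω hω
      rw [hAE] at hω
      exact hω
    have h3 : ∫ ω in Y ⁻¹' A, ((1:ℝ) - G ω) ∂P = 0 := by
      rw [integral_sub (integrable_const _).integrableOn hGi.integrableOn, ← h1, h2, sub_self]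
    have h4 := (setIntegral_eq_zero_iff_of_nonneg_ae
      (Filter.Eventually.of_forall fun ω => by
        have := (le_abs_self _).trans (hgb (rbridge W τ Z (T2 + 1) ω))
        simpa [hGdef] using this) ((integrable_const _).sub hGi).integrableOn).1 h3
    rw [Filter.EventuallyEq, ae_restrict_iff' hEmm] at h4
    filter_upwards [h4] with ω h5 h6
    have := h5 h6
    simp only [Pi.zero_apply, Pi.sub_apply] at this
    linarith
  have hno : ∀ᵐ ω ∂P, ¬ (τ ω = T2 ∧ Z ω ∉ D ∧
      (W t2 ω - t2 / T2 * W T2 ω) + t2 / T2 * Z ω ∈ A) := by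
    filter_upwards [hE, hGZ] with ω h1 h2 h3
    obtain ⟨h4, h5, h6⟩ := h3
    rw [← hmid ω t2 h4 ht2'.le] at h6
    have h7 := h1 h6
    rw [h2] at h7
    simp [g, h5] at h7
  rw [ae_iff] at hno
  simpa only [not_not] using hno
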